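/- (Clunie; the entire case of Hayman's conjecture.) Let f be a transcendental entire function, let n ≥ 1 be an integer, and let c ∈ ℂ with c ≠ 0. Then the set {z ∈ ℂ : f(z)^n f'(z) = c} is infinite. -/

import Mathlib

open Metric Set Filter Topology

/-- logarithm on a convex open set -/
lemma ch_log_convex {S : Set ℂ} (hS : IsOpen S) (hc : Convex ℝ S) {F : ℂ → ℂ}
    (hF : DifferentiableOn ℂ F S) (hne : ∀ z ∈ S, F z ≠ 0) (z0 : ℂ) (hz0 : z0 ∈ S)
    (hex : Complex.IsExactOn (fun z => deriv F z / F z) S) :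
    ∃ q : ℂ → ℂ, DifferentiableOn ℂ q S ∧ ∀ z ∈ S, F z = Complex.exp (q z) := by
  obtain ⟨q, hq0, hq⟩ := hex.with_val_at z0 (Complex.log (F z0))
  refine ⟨q, fun z hz => (hq z hz).differentiableAt.differentiableWithinAt, ?_⟩
  have hder : ∀ z ∈ S, HasDerivAt (fun z => F z * Complex.exp (-q z)) 0 z := by
    intro z hz
    have h1 : HasDerivAt F (deriv F z) z :=
      ((hF z hz).differentiableAt (hS.mem_nhds hz)).hasDerivAt
    have h2 := h1.mul (hq z hz).neg.cexp
    refine h2.congr_deriv ?_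
    have := hne z hz
    field_simp
    ring
  intro z hz
  have hconst : F z * Complex.exp (-q z) = F z0 * Complex.exp (-q z0) := by
    have := hc.is_const_of_fderivWithin_eq_zero (𝕜 := ℂ) (f := fun z => F z * Complex.exp (-q z))
      (fun w hw => (hder w hw).differentiableAt.differentiableWithinAt)
      (fun w hw => by
        rw [fderivWithin_of_isOpen hS hw]
        have := (hder w hw).hasFDerivAt.fderiv
        rw [this]; ext; simp) hz hz0
    exact this
  rw [hq0, Complex.exp_neg (Complex.log _), Complex.exp_log (hne z0 hz0),
    mul_inv_cancel₀ (hne z0 hz0), Complex.exp_neg] at hconst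
  field_simp at hconst
  exact hconst

lemma ch_log_ball {F : ℂ → ℂ} {z0 : ℂ} {d : ℝ} (hd : 0 < d)
    (hF : DifferentiableOn ℂ F (ball z0 d)) (hne : ∀ z ∈ ball z0 d, F z ≠ 0) :
    ∃ q : ℂ → ℂ, DifferentiableOn ℂ q (ball z0 d) ∧ ∀ z ∈ ball z0 d, F z = Complex.exp (q z) :=
  ch_log_convex isOpen_ball (convex_ball _ _) hF hne z0 (mem_ball_self hd)
    (DifferentiableOn.isExactOn_ball ((hF.deriv isOpen_ball).div hF hne))

lemma ch_log_univ {F : ℂ → ℂ} (hF : Differentiable ℂ F) (hne : ∀ z, F z ≠ 0) :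
    ∃ q : ℂ → ℂ, Differentiable ℂ q ∧ ∀ z, F z = Complex.exp (q z) := by
  obtain ⟨q, h1, h2⟩ := ch_log_convex isOpen_univ convex_univ hF.differentiableOn
    (fun z _ => hne z) 0 (mem_univ _) (Differentiable.isExactOn_univ (by
      have : Differentiable ℂ (deriv F) := hF.deriv
      exact this.div hF hne))
  exact ⟨q, differentiableOn_univ.1 h1, fun z => h2 z (mem_univ _)⟩

/-- Harnack inequality for `log |f|`. -/
lemma ch_harnack {f : ℂ → ℂ} {z0 : ℂ} {d : ℝ} (hd : 0 < d)
    (hf : DifferentiableOn ℂ f (ball z0 d)) (h1 : ∀ z ∈ ball z0 d, 1 < ‖f z‖) :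
    (∀ z ∈ ball z0 d, Real.log ‖f z0‖ * (d - dist z z0) ≤ Real.log ‖f z‖ * (d + dist z z0)) ∧
    ‖deriv f z0‖ / ‖f z0‖ ≤ 2 * Real.log ‖f z0‖ / d := by
  have hne : ∀ z ∈ ball z0 d, f z ≠ 0 := by
    intro z hz h
    have := h1 z hz
    rw [h, norm_zero] at this; linarith
  obtain ⟨q, hq, hfq⟩ := ch_log_ball hd hf hne
  have hz0 : z0 ∈ ball z0 d := mem_ball_self hd
  have hre : ∀ z ∈ ball z0 d, Real.log ‖f z‖ = (q z).re := by
    intro z hz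
    rw [hfq z hz, Complex.norm_exp, Real.log_exp]
  have hpos : ∀ z ∈ ball z0 d, 0 < (q z).re := by
    intro z hz
    rw [← hre z hz]; exact Real.log_pos (h1 z hz)
  set a := q z0 with ha
  have ha0 : 0 < a.re := hpos z0 hz0
  have hden : ∀ z ∈ ball z0 d, q z + (starRingEnd ℂ) a ≠ 0 := by
    intro z hz h
    have := congrArg Complex.re h
    simp at this
    linarith [hpos z hz]
  set φ : ℂ → ℂ := fun z => (q z - a) / (q z + (starRingEnd ℂ) a) with hφ
  have hφd : DifferentiableOn ℂ φ (ball z0 d) :=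
    (hq.sub_const _).div (hq.add_const _) hden
  have hφ0 : φ z0 = 0 := by simp [hφ, ha]
  have hmaps : MapsTo φ (ball z0 d) (closedBall (φ z0) 1) := by
    intro z hz
    rw [hφ0, mem_closedBall_zero_iff, hφ]
    simp only [norm_div]
    apply div_le_one_of_le₀ _ (norm_nonneg _)
    rw [← sq_le_sq₀ (norm_nonneg _) (norm_nonneg _), Complex.sq_norm, Complex.sq_norm,
      Complex.normSq_apply, Complex.normSq_apply]
    simp
    nlinarith [hpos z hz]
  refine ⟨?_, ?_⟩
  · intro z hz
    have hs := Complex.dist_le_div_mul_dist_of_mapsTo_ball hφd hmaps hz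
    rw [hφ0, dist_zero_right] at hs
    simp only [hφ, norm_div] at hs
    have hdp : 0 < ‖q z + (starRingEnd ℂ) a‖ := norm_pos_iff.2 (hden z hz)
    rw [div_le_iff₀ hdp] at hs
    set r := dist z z0 with hr
    have hr0 : 0 ≤ r := dist_nonneg
    have hrd : r < d := hz
    have hs2 : d * ‖q z - a‖ ≤ r * ‖q z + (starRingEnd ℂ) a‖ := by
      have := mul_le_mul_of_nonneg_left hs hd.le
      have e : d * (1 / d * r * ‖q z + (starRingEnd ℂ) a‖) = r * ‖q z + (starRingEnd ℂ) a‖ := by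
        field_simp
      linarith
    have hs3 : (d * ‖q z - a‖)^2 ≤ (r * ‖q z + (starRingEnd ℂ) a‖)^2 :=
      pow_le_pow_left₀ (by positivity) hs2 2
    rw [mul_pow, mul_pow, Complex.sq_norm, Complex.sq_norm,
      Complex.normSq_apply, Complex.normSq_apply] at hs3
    simp at hs3
    rw [hre z hz, hre z0 hz0, ← ha]
    set X := (q z).re
    set A := a.re
    set Y := (q z).im - a.im with hY
    have e : (q z).im + -a.im = Y := by ring
    rw [e] at hs3
    have hX : 0 < X := hpos z hz
    have h4 : (d * (X - A))^2 ≤ (r * (X + A))^2 := by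
      have : r^2 * (Y*Y) ≤ d^2 * (Y*Y) := by
        apply mul_le_mul_of_nonneg_right _ (mul_self_nonneg _)
        exact pow_le_pow_left₀ hr0 hrd.le 2
      nlinarith
    have h5 := abs_le_of_sq_le_sq h4 (by positivity)
    have h6 := (abs_le.1 h5).1
    nlinarith
  · have hs := Complex.norm_deriv_le_div_of_mapsTo_ball hφd hmaps hd
    have hqd : HasDerivAt q (deriv q z0) z0 :=
      ((hq z0 hz0).differentiableAt (isOpen_ball.mem_nhds hz0)).hasDerivAt
    have hφ' : HasDerivAt φ (deriv q z0 / (2 * a.re)) z0 := by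
      have h := (hqd.sub_const a).div (hqd.add_const ((starRingEnd ℂ) a)) (hden z0 hz0)
      refine h.congr_deriv ?_
      have e : q z0 + (starRingEnd ℂ) a = 2 * a.re := by
        rw [← ha, Complex.add_conj]; push_cast; ring
      rw [e, ← ha, sub_self]
      have : (a.re : ℂ) ≠ 0 := by exact_mod_cast ha0.ne'
      field_simp
      ring
    rw [hφ'.deriv, norm_div] at hs
    have hf' : deriv f z0 = f z0 * deriv q z0 := by
      have h : f =ᶠ[𝓝 z0] fun z => Complex.exp (q z) := by
        filter_upwards [isOpen_ball.mem_nhds hz0] with z hz using hfq z hz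
      rw [h.deriv_eq, hqd.cexp.deriv, hfq z0 hz0]
    rw [hf', norm_mul, mul_div_assoc, hre z0 hz0, ← ha]
    have hfp : ‖f z0‖ ≠ 0 := norm_ne_zero_iff.2 (hne z0 hz0)
    have e1 : ‖f z0‖ * (‖deriv q z0‖ / ‖f z0‖) = ‖deriv q z0‖ := by field_simp
    rw [e1]
    have e2 : ‖(2 * (a.re:ℂ))‖ = 2 * a.re := by
      rw [norm_mul, Complex.norm_real, Real.norm_eq_abs, abs_of_pos ha0]; simp
    rw [e2, div_le_iff₀ (by positivity)] at hs
    calc _ ≤ _ := hs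
      _ = _ := by ring

lemma ch_hopf {f : ℂ → ℂ} {z0 z1 : ℂ} {d : ℝ} (hd : 0 < d)
    (hf : Differentiable ℂ f) (h1 : ∀ z ∈ ball z0 d, 1 < ‖f z‖) (hz1 : dist z1 z0 = d)
    (hf1 : ‖f z1‖ = 1) : Real.log ‖f z0‖ ≤ 2 * d * ‖deriv f z1‖ := by
  have hh := (ch_harnack hd hf.differentiableOn h1).1
  set u := Real.log ‖f z0‖
  have hu : 0 ≤ u := Real.log_nonneg (h1 z0 (mem_ball_self hd)).le
  -- difference quotients
  have hder : HasDerivAt f (deriv f z1) z1 := (hf z1).hasDerivAt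
  have hcurve : HasDerivAt (fun t : ℝ => f (z1 + t * (z0 - z1))) (deriv f z1 * (z0 - z1)) 0 := by
    have hg : HasDerivAt (fun t : ℝ => z1 + (t:ℂ) * (z0 - z1)) (z0 - z1) 0 := by
      have := (((hasDerivAt_id (0:ℝ)).ofReal_comp).mul_const (z0 - z1)).const_add z1
      simpa using this
    have : HasDerivAt f (deriv f z1) (z1 + ((0:ℝ):ℂ) * (z0 - z1)) := by simpa using hder
    exact this.comp (0:ℝ) hg
  have hslope := hcurve.tendsto_slope_zero_right
  have hn := hslope.norm
  have hle : ∀ᶠ t : ℝ in 𝓝[>] 0, u / 2 ≤ ‖t⁻¹ • (f (z1 + ((0 + t : ℝ):ℂ) * (z0 - z1)) - f (z1 + ((0:ℝ):ℂ) * (z0 - z1)))‖ := by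
    filter_upwards [Ioo_mem_nhdsGT (show (0:ℝ) < 1 by norm_num)] with t ht
    have ht0 : 0 < t := ht.1
    have hdist : dist (z1 + (t:ℂ) * (z0 - z1)) z0 = (1 - t) * d := by
      rw [dist_eq_norm, show z1 + (t:ℂ) * (z0 - z1) - z0 = ((1 - t : ℝ):ℂ) * (z1 - z0) by
        push_cast; ring, norm_mul, Complex.norm_real, Real.norm_eq_abs, abs_of_pos (by linarith [ht.2]),
        ← dist_eq_norm, hz1]
    have hmem : z1 + (t:ℂ) * (z0 - z1) ∈ ball z0 d := by
      rw [mem_ball, hdist]; nlinarith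
    have h2 := hh _ hmem
    rw [hdist] at h2
    set w := z1 + (t:ℂ) * (z0 - z1) with hw
    have h3 : Real.log ‖f w‖ ≤ ‖f w‖ - 1 := Real.log_le_sub_one_of_pos (by linarith [h1 w hmem])
    have h4 : ‖f w‖ - 1 ≤ ‖f w - f z1‖ := by
      rw [← hf1]; exact norm_sub_norm_le _ _
    simp only [zero_add, Complex.ofReal_zero, zero_mul, add_zero]
    rw [norm_smul, norm_inv, Real.norm_eq_abs, abs_of_pos ht0, ← hw, inv_mul_eq_div, le_div_iff₀ ht0]
    have h5 : u * t ≤ Real.log ‖f w‖ * (2 - t) := by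
      have : u * t * d ≤ Real.log ‖f w‖ * (2 - t) * d := by nlinarith
      exact le_of_mul_le_mul_right this hd
    have h6 : 0 ≤ Real.log ‖f w‖ := Real.log_nonneg (h1 w hmem).le
    nlinarith
  have := ge_of_tendsto hn hle
  rw [norm_mul, ← dist_eq_norm, dist_comm, hz1] at this
  linarith

lemma ch_nearest {f : ℂ → ℂ} (hf : Continuous f) {A : ℝ} {z w : ℂ} (hz : A < ‖f z‖)
    (hw : ‖f w‖ ≤ A) : ∃ d > 0, ∃ z1, dist z1 z = d ∧ ‖f z1‖ = A ∧ d ≤ dist w z ∧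
      ∀ x ∈ ball z d, A < ‖f x‖ := by
  set S : Set ℂ := {x | ‖f x‖ ≤ A} with hS
  have hSc : IsClosed S := isClosed_le hf.norm continuous_const
  have hne : S.Nonempty := ⟨w, hw⟩
  obtain ⟨z1, hz1, hd⟩ := hSc.exists_infDist_eq_dist hne z
  have hball : ∀ x ∈ ball z (dist z z1), A < ‖f x‖ := by
    intro x hx
    by_contra h
    push Not at h
    have : infDist z S ≤ dist z x := infDist_le_dist_of_mem h
    rw [hd, dist_comm z x] at this
    exact absurd hx (not_lt.2 this)
  have hpos : 0 < dist z z1 := by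
    rw [dist_pos]; rintro rfl
    exact absurd hz1 (not_le.2 hz)
  refine ⟨dist z z1, hpos, z1, dist_comm _ _, le_antisymm hz1 ?_, ?_, hball⟩
  · have hcl : z1 ∈ closure (ball z (dist z z1)) := by
      rw [closure_ball z hpos.ne', mem_closedBall, dist_comm]
    have : closure (ball z (dist z z1)) ⊆ {x | A ≤ ‖f x‖} :=
      closure_minimal (fun x hx => (hball x hx).le) (isClosed_le continuous_const hf.norm)
    exact this hcl
  · rw [← hd, dist_comm w z]; exact infDist_le_dist_of_mem hw

lemma ch_growth {f : ℂ → ℂ} (hf : Differentiable ℂ f) {A K R : ℝ} (hA : 1 ≤ A) (hK : 0 ≤ K)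
    (h0 : ‖f 0‖ ≤ A) (hb : ∀ w, ‖w‖ ≤ R → ‖deriv f w‖ ≤ K * (1 + ‖f w‖ ^ 2)) {z : ℂ}
    (hz : 2 * ‖z‖ ≤ R) : ‖f z‖ ≤ A * Real.exp (4 * K * A * ‖z‖) := by
  have hA0 : 0 < A := by linarith
  have he : 1 ≤ Real.exp (4 * K * A * ‖z‖) := Real.one_le_exp (by positivity)
  by_cases h : ‖f z‖ ≤ A
  · nlinarith
  push Not at h
  obtain ⟨d, hd, z1, hz1, hfz1, hdz, hball⟩ := ch_nearest hf.continuous h h0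
  have hdz' : d ≤ ‖z‖ := by simpa using hdz
  have hn : ∀ x, ‖f x / A‖ = ‖f x‖ / A := by
    intro x; rw [norm_div, Complex.norm_real, Real.norm_eq_abs, abs_of_pos hA0]
  have hh := ch_hopf (f := fun x => f x / A) hd (hf.div_const _)
    (fun x hx => by rw [hn, lt_div_iff₀ hA0, one_mul]; exact hball x hx) hz1
    (by rw [hn, hfz1, div_self hA0.ne'])
  rw [hn, deriv_div_const, norm_div, Complex.norm_real, Real.norm_eq_abs, abs_of_pos hA0] at hh
  have hz1n : ‖z1‖ ≤ R := by
    have : ‖z1‖ ≤ ‖z1 - z‖ + ‖z‖ := norm_le_norm_sub_add z1 z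
    rw [← dist_eq_norm, hz1] at this
    linarith
  have h2 := hb z1 hz1n
  rw [hfz1] at h2
  have h3 : ‖deriv f z1‖ / A ≤ 2 * K * A := by
    rw [div_le_iff₀ hA0]
    have : 1 + A^2 ≤ 2 * A * A := by nlinarith
    nlinarith
  have h4 : Real.log (‖f z‖ / A) ≤ 4 * K * A * ‖z‖ := by
    calc _ ≤ _ := hh
      _ ≤ 2 * ‖z‖ * (2 * K * A) := by gcongr
      _ = _ := by ring
  have h5 : ‖f z‖ / A ≤ Real.exp (4 * K * A * ‖z‖) := by
    rwa [Real.log_le_iff_le_exp (div_pos (by linarith) hA0)] at h4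
  rw [div_le_iff₀ hA0] at h5
  linarith

lemma ch_bound_zero {f : ℂ → ℂ} (hf : Differentiable ℂ f) {κ K R : ℝ} (hκ : 0 < κ) (hK : 0 ≤ K)
    (hR : 1 ≤ R) (hb : ∀ w, ‖w‖ ≤ R → ‖deriv f w‖ ≤ K * (1 + ‖f w‖ ^ 2))
    (h0 : κ * (1 + ‖f 0‖ ^ 2) ≤ ‖deriv f 0‖) : ‖f 0‖ ≤ 1 + 8 * K / κ + 16 / κ ^ 2 := by
  have p1 : 0 ≤ 8 * K / κ := by positivity
  have p2 : 0 ≤ 16 / κ ^ 2 := by positivity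
  by_cases h : ‖f 0‖ ≤ 1
  · linarith
  push Not at h
  set a := ‖f 0‖ with ha
  have ha0 : 0 < a := by linarith
  have key : κ * a ≤ ‖deriv f 0‖ / a := by
    rw [le_div_iff₀ ha0]; nlinarith
  by_cases hex : ∃ w ∈ ball (0:ℂ) 1, ‖f w‖ ≤ 1
  · obtain ⟨w, hw, hfw⟩ := hex
    obtain ⟨d, hd, z1, hz1, hfz1, hdz, hball⟩ := ch_nearest hf.continuous h hfw
    have hd1 : d ≤ 1 := hdz.trans (le_of_lt hw)
    have h1 := ch_hopf hd hf hball hz1 hfz1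
    have h2 := (ch_harnack hd hf.differentiableOn hball).2
    have h3 := hb z1 (by rw [dist_zero_right] at hz1; linarith)
    rw [hfz1] at h3
    rw [← ha] at h1 h2
    have h4 : 2 * Real.log a / d ≤ 8 * K := by
      rw [div_le_iff₀ hd]; nlinarith
    have : a ≤ 8 * K / κ := by rw [le_div_iff₀ hκ]; linarith
    linarith
  · push Not at hex
    have h2 := (ch_harnack one_pos hf.differentiableOn hex).2
    rw [← ha, div_one] at h2
    have h3 : Real.log a ≤ 2 * Real.sqrt a := by
      have := Real.log_le_sub_one_of_pos (Real.sqrt_pos.2 ha0)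
      rw [Real.log_sqrt ha0.le] at this
      linarith
    have hs : 0 < Real.sqrt a := Real.sqrt_pos.2 ha0
    have hss : Real.sqrt a * Real.sqrt a = a := Real.mul_self_sqrt ha0.le
    have h4 : κ * Real.sqrt a ≤ 4 := by
      have : κ * Real.sqrt a * Real.sqrt a ≤ 4 * Real.sqrt a := by
        rw [mul_assoc, hss]; linarith
      exact le_of_mul_le_mul_right this hs
    have : a ≤ 16 / κ ^ 2 := by
      rw [le_div_iff₀ (by positivity)]
      have h5 : (κ * Real.sqrt a)^2 ≤ 4^2 := pow_le_pow_left₀ (by positivity) h4 2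
      nlinarith
    linarith

lemma ch_linear {q : ℂ → ℂ} (hq : Differentiable ℂ q) {A B : ℝ} (hA : 0 ≤ A) (hB : 0 ≤ B)
    (h : ∀ z, (q z).re ≤ A + B * ‖z‖) : ∃ a, ∀ z, q z = q 0 + a * z := by
  set C : ℝ := 2 * (A + 1) + 4 * B + 3 * ‖q 0‖ with hC
  have hC0 : 0 ≤ C := by positivity
  have hbd : ∀ z, ‖q z‖ ≤ C * (1 + ‖z‖) := by
    intro z
    have hz0 : 0 ≤ ‖z‖ := norm_nonneg z
    set R : ℝ := 2 * (‖z‖ + 1) with hR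
    have hbc := Complex.borelCaratheodory (M := A + 1 + B * R) (f := q) (R := R) (z := z)
      (by positivity) hq.differentiableOn (fun w hw => by
        have hw' : ‖w‖ < R := mem_ball_zero_iff.1 hw
        have := h w
        have h3 : B * ‖w‖ ≤ B * R := by gcongr
        show (q w).re ≤ _
        linarith) (by positivity) (by rw [mem_ball_zero_iff]; linarith)
    have hd : 0 < R - ‖z‖ := by linarith
    have e1 : 2 * (A + 1 + B * R) * ‖z‖ / (R - ‖z‖) ≤ 2 * (A + 1 + B * R) := by
      rw [div_le_iff₀ hd]
      apply mul_le_mul_of_nonneg_left (by linarith) (by positivity)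
    have e2 : ‖q 0‖ * (R + ‖z‖) / (R - ‖z‖) ≤ 3 * ‖q 0‖ := by
      rw [div_le_iff₀ hd]
      nlinarith [norm_nonneg (q 0)]
    have : ‖q z‖ ≤ 2 * (A + 1 + B * R) + 3 * ‖q 0‖ := by linarith
    rw [hC]
    have : 0 ≤ ‖q 0‖ * ‖z‖ := by positivity
    have : 0 ≤ A * ‖z‖ := by positivity
    nlinarith
  have hq' : Differentiable ℂ (deriv q) := hq.deriv
  have hder : ∀ c, ‖deriv q c‖ ≤ 2 * C := by
    intro c
    have hc0 : 0 ≤ ‖c‖ := norm_nonneg c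
    have := Complex.norm_deriv_le_of_forall_mem_sphere_norm_le (c := c) (R := 1 + ‖c‖)
      (C := C * (2 + 2 * ‖c‖)) (by positivity) hq.diffContOnCl (fun z hz => by
        refine (hbd z).trans ?_
        have h1 : ‖z‖ ≤ ‖z - c‖ + ‖c‖ := norm_le_norm_sub_add z c
        rw [mem_sphere_iff_norm.1 hz] at h1
        apply mul_le_mul_of_nonneg_left _ hC0; linarith)
    refine this.trans ?_
    rw [div_le_iff₀ (by positivity)]
    linarith
  obtain ⟨a, ha⟩ := hq'.exists_const_forall_eq_of_bounded
    (isBounded_iff_forall_norm_le.2 ⟨2 * C, by rintro _ ⟨c, rfl⟩; exact hder c⟩)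
  refine ⟨a, fun z => ?_⟩
  have hconst := is_const_of_deriv_eq_zero (f := fun z => q z - a * z)
    (hq.sub (differentiable_id.const_mul a)) (fun z => by
      have : HasDerivAt (fun z => q z - a * z) (deriv q z - a * 1) z :=
        ((hq z).hasDerivAt).sub ((hasDerivAt_id z).const_mul a)
      rw [this.deriv, ha]; ring) z 0
  simp at hconst
  rw [← hconst]; ring

lemma ch_divide {G : ℂ → ℂ} (hG : Differentiable ℂ G) (w : ℂ) (hne : ∃ z, G z ≠ 0) :
    ∃ (k : ℕ) (H : ℂ → ℂ), Differentiable ℂ H ∧ H w ≠ 0 ∧ ∀ z, G z = (z - w) ^ k * H z := by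
  have han : AnalyticAt ℂ G w := hG.analyticAt w
  obtain ⟨p, hp⟩ := han
  have hp0 : p ≠ 0 := by
    rintro rfl
    have h1 : G =ᶠ[𝓝 w] 0 := hp.eventually_eq_zero
    have : G = 0 := by
      have := AnalyticOnNhd.eqOn_zero_of_preconnected_of_eventuallyEq_zero
        (f := G) (U := univ) (fun z _ => hG.analyticAt z) isPreconnected_univ (mem_univ w) h1
      ext z; exact this (mem_univ z)
    obtain ⟨z, hz⟩ := hne
    exact hz (by rw [this]; rfl)
  refine ⟨p.order, (Function.swap dslope w)^[p.order] G, ?_, hp.iterate_dslope_fslope_ne_zero hp0, ?_⟩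
  · have : ∀ k, Differentiable ℂ ((Function.swap dslope w)^[k] G) := by
      intro k
      induction k with
      | zero => simpa using hG
      | succ k ih =>
        rw [Function.iterate_succ_apply']
        have := (Complex.differentiableOn_dslope (f := (Function.swap dslope w)^[k] G)
          (s := univ) (c := w) univ_mem).2 ih.differentiableOn
        exact differentiableOn_univ.1 this
    exact this _
  · intro z
    have := hp.eq_pow_order_mul_iterate_dslope z
    simpa using this

lemma ch_factor_aux (N : ℕ) : ∀ {G : ℂ → ℂ} (_ : Differentiable ℂ G) {A B : ℝ} (_ : 0 ≤ A)
    (_ : 0 ≤ B) (_ : ∀ z, ‖G z‖ ≤ A * Real.exp (B * ‖z‖)) (_ : {z | G z = 0}.Finite)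
    (_ : {z | G z = 0}.ncard = N),
    ∃ (P : Polynomial ℂ) (a : ℂ), P ≠ 0 ∧ ∀ z, G z = P.eval z * Complex.exp (a * z) := by
  induction N with
  | zero =>
    intro G hG A B hA hB hb hfin hcard
    have hne : ∀ z, G z ≠ 0 := by
      have := (Set.ncard_eq_zero hfin).1 hcard
      intro z hz
      have h2 : z ∈ {z | G z = 0} := hz
      rw [this] at h2; exact h2
    obtain ⟨q, hq, hGq⟩ := ch_log_univ hG hne
    obtain ⟨a, ha⟩ := ch_linear hq hA hB (fun z => by
      have h1 := hb z
      rw [hGq z, Complex.norm_exp] at h1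
      have h2 : A ≤ Real.exp A := by linarith [Real.add_one_le_exp A]
      have h3 : Real.exp (q z).re ≤ Real.exp (A + B * ‖z‖) := by
        rw [Real.exp_add]
        refine h1.trans ?_
        gcongr
      exact Real.exp_le_exp.1 h3)
    refine ⟨Polynomial.C (Complex.exp (q 0)), a, by simp [Complex.exp_ne_zero], fun z => ?_⟩
    rw [hGq z, ha z, Complex.exp_add, Polynomial.eval_C]
  | succ N ih =>
    intro G hG A B hA hB hb hfin hcard
    have hex : ∃ w, G w = 0 := by
      have : {z | G z = 0}.Nonempty := by
        rw [← Set.ncard_pos hfin]; omega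
      exact this
    obtain ⟨w, hw⟩ := hex
    have hne : ∃ z, G z ≠ 0 := by
      by_contra h
      push Not at h
      have : {z | G z = 0} = univ := by ext z; simp [h z]
      rw [this] at hfin
      exact Set.infinite_univ hfin
    obtain ⟨k, H, hH, hHw, hGH⟩ := ch_divide hG w hne
    have hset : {z | H z = 0} = {z | G z = 0} \ {w} := by
      ext z
      simp only [Set.mem_ofPred_eq, Set.mem_sdiff, Set.mem_singleton_iff]
      constructor
      · intro h
        refine ⟨by rw [hGH, h, mul_zero], ?_⟩
        rintro rfl; exact hHw h
      · rintro ⟨h1, h2⟩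
        rw [hGH] at h1
        rcases mul_eq_zero.1 h1 with h3 | h3
        · exact absurd (sub_eq_zero.1 (eq_zero_of_pow_eq_zero h3)) h2
        · exact h3
    obtain ⟨C, hC⟩ := (isCompact_closedBall w 1).exists_bound_of_continuousOn hH.continuous.continuousOn
    have hC0 : 0 ≤ C := (norm_nonneg _).trans (hC w (mem_closedBall_self zero_le_one))
    obtain ⟨P, a, hP, hHP⟩ := ih hH (A := A + C) (B := B) (by positivity) hB (fun z => by
      have he : 1 ≤ Real.exp (B * ‖z‖) := Real.one_le_exp (by positivity)
      by_cases hz : z ∈ closedBall w 1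
      · have := hC z hz
        nlinarith
      · have hz1 : 1 ≤ ‖z - w‖ := by
          rw [mem_closedBall, dist_eq_norm] at hz; push Not at hz; exact hz.le
        have h1 := hb z
        rw [hGH z, norm_mul, norm_pow] at h1
        have h2 : 1 ≤ ‖z - w‖ ^ k := one_le_pow₀ hz1
        have : 0 ≤ ‖H z‖ := norm_nonneg _
        nlinarith) (hset ▸ hfin.sdiff) (by
        rw [hset, Set.ncard_sdiff_singleton_of_mem (show w ∈ {z | G z = 0} from hw), hcard]
        rfl)
    refine ⟨(Polynomial.X - Polynomial.C w) ^ k * P, a, ?_, fun z => ?_⟩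
    · exact mul_ne_zero (pow_ne_zero _ (Polynomial.X_sub_C_ne_zero w)) hP
    · rw [hGH z, hHP z]; simp; ring

lemma ch_factor {G : ℂ → ℂ} (hG : Differentiable ℂ G) {A B : ℝ} (hA : 0 ≤ A)
    (hB : 0 ≤ B) (hb : ∀ z, ‖G z‖ ≤ A * Real.exp (B * ‖z‖)) (hfin : {z | G z = 0}.Finite) :
    ∃ (P : Polynomial ℂ) (a : ℂ), P ≠ 0 ∧ ∀ z, G z = P.eval z * Complex.exp (a * z) :=
  ch_factor_aux _ hG hA hB hb hfin rfl

open Polynomial in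
lemma ch_T_inj {s : ℂ} (hs : s ≠ 0) {Q : Polynomial ℂ} (h : derivative Q + C s * Q = 0) : Q = 0 := by
  by_contra hQ
  have h1 : degree (C s * Q) = degree Q := degree_C_mul hs
  have h2 : degree (derivative Q) < degree Q := degree_derivative_lt hQ
  rw [← h1] at h2
  have h3 := degree_add_eq_right_of_degree_lt h2
  rw [h, h1, degree_zero] at h3
  exact hQ (degree_eq_bot.1 h3.symm)

open Polynomial in
lemma ch_T_surj {s : ℂ} (hs : s ≠ 0) (N : ℕ) : ∀ P : Polynomial ℂ, degree P < N →
    ∃ Q, derivative Q + C s * Q = P := by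
  induction N with
  | zero =>
    intro P hP
    refine ⟨0, ?_⟩
    have : P = 0 := by
      rw [← degree_eq_bot]
      simpa using hP
    simp [this]
  | succ N ih =>
    intro P hP
    obtain ⟨Q1, hQ1⟩ := ih (C s⁻¹ * derivative P) (by
      rw [degree_C_mul (inv_ne_zero hs)]
      by_cases hP0 : P = 0
      · simp [hP0]
      have := degree_derivative_lt hP0
      have h2 : degree P ≤ N := by
        rw [degree_eq_natDegree hP0] at hP ⊢
        exact_mod_cast Nat.lt_succ_iff.1 (by exact_mod_cast hP)
      exact this.trans_le h2)
    refine ⟨C s⁻¹ * P - Q1, ?_⟩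
    have e : C s * C s⁻¹ = (1 : Polynomial ℂ) := by rw [← C_mul, mul_inv_cancel₀ hs, C_1]
    rw [derivative_sub, derivative_C_mul]
    linear_combination P * e - hQ1

open Polynomial in
lemma ch_hasDeriv (Q : Polynomial ℂ) (s z : ℂ) :
    HasDerivAt (fun z => Q.eval z * Complex.exp (s * z))
      ((derivative Q + C s * Q).eval z * Complex.exp (s * z)) z := by
  have h1 := Q.hasDerivAt z
  have h2 : HasDerivAt (fun z => Complex.exp (s * z)) (Complex.exp (s * z) * s) z := by
    have := ((hasDerivAt_id z).const_mul s).cexp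
    simpa using this
  refine (h1.mul h2).congr_deriv ?_
  simp; ring

open Polynomial in
lemma ch_indep1 {s : ℂ} (hs : s ≠ 0) (N : ℕ) : ∀ P Q : Polynomial ℂ, degree P < N →
    (∀ z, P.eval z + Q.eval z * Complex.exp (s * z) = 0) → Q = 0 := by
  induction N with
  | zero =>
    intro P Q hP h
    have : P = 0 := by
      rw [← degree_eq_bot]
      simpa using hP
    subst this
    apply Polynomial.funext
    intro z
    have := h z
    simpa [Complex.exp_ne_zero] using this
  | succ N ih =>
    intro P Q hP h
    apply ch_T_inj hs
    apply ih (derivative P) _ _ _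
    · by_cases hP0 : P = 0
      · simp [hP0]
      have := degree_derivative_lt hP0
      have h2 : degree P ≤ N := by
        rw [degree_eq_natDegree hP0] at hP ⊢
        exact_mod_cast Nat.lt_succ_iff.1 (by exact_mod_cast hP)
      exact this.trans_le h2
    · intro z
      have h1 := (P.hasDerivAt z).add (ch_hasDeriv Q s z)
      have h2 : ((fun z => P.eval z) + fun z => Q.eval z * Complex.exp (s * z)) = fun _ => 0 := by
        ext z; exact h z
      rw [h2] at h1
      exact h1.unique (hasDerivAt_const z 0)

open Polynomial in
lemma ch_indep2 {a b : ℂ} (ha : a ≠ 0) (hb : b ≠ 0) (hab : a ≠ b) (N : ℕ) :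
    ∀ P Q S : Polynomial ℂ, degree P < N →
    (∀ z, P.eval z + Q.eval z * Complex.exp (a * z) + S.eval z * Complex.exp (b * z) = 0) →
    S = 0 := by
  induction N with
  | zero =>
    intro P Q S hP h
    have : P = 0 := by
      rw [← degree_eq_bot]
      simpa using hP
    subst this
    apply ch_indep1 (sub_ne_zero.2 hab.symm) (natDegree Q + 1) Q S
    · exact_mod_cast lt_of_le_of_lt degree_le_natDegree (by exact_mod_cast Nat.lt_succ_self _)
    · intro z
      have := h z
      have e : Complex.exp (b * z) = Complex.exp ((b - a) * z) * Complex.exp (a * z) := by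
        rw [← Complex.exp_add]; ring_nf
      rw [e, eval_zero] at this
      have h2 : (Q.eval z + S.eval z * Complex.exp ((b - a) * z)) * Complex.exp (a * z) = 0 := by
        linear_combination this
      exact (mul_eq_zero.1 h2).resolve_right (Complex.exp_ne_zero _)
  | succ N ih =>
    intro P Q S hP h
    apply ch_T_inj hb
    apply ih (derivative P) (derivative Q + C a * Q) _ _ _
    · by_cases hP0 : P = 0
      · simp [hP0]
      have := degree_derivative_lt hP0
      have h2 : degree P ≤ N := by
        rw [degree_eq_natDegree hP0] at hP ⊢
        exact_mod_cast Nat.lt_succ_iff.1 (by exact_mod_cast hP)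
      exact this.trans_le h2
    · intro z
      have h1 := ((P.hasDerivAt z).add (ch_hasDeriv Q a z)).add (ch_hasDeriv S b z)
      have h2 : ((fun z => P.eval z) + (fun z => Q.eval z * Complex.exp (a * z)) +
          fun z => S.eval z * Complex.exp (b * z)) = fun _ => 0 := by
        ext z; exact h z
      rw [h2] at h1
      exact h1.unique (hasDerivAt_const z 0)

open Polynomial in
lemma ch_deg_lt (P : Polynomial ℂ) : degree P < ((natDegree P + 1 : ℕ) : WithBot ℕ) :=
  lt_of_le_of_lt degree_le_natDegree (by exact_mod_cast Nat.lt_succ_self _)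

lemma ch_deriv_growth {g : ℂ → ℂ} (hg : Differentiable ℂ g) {A B : ℝ} (hA : 0 ≤ A)
    (hB : 0 ≤ B) (hb : ∀ z, ‖g z‖ ≤ A * Real.exp (B * ‖z‖)) (z : ℂ) :
    ‖deriv g z‖ ≤ A * Real.exp B * Real.exp (B * ‖z‖) := by
  have := Complex.norm_deriv_le_of_forall_mem_sphere_norm_le (c := z) (R := 1)
    (C := A * Real.exp B * Real.exp (B * ‖z‖)) one_pos hg.diffContOnCl (fun w hw => by
      refine (hb w).trans ?_
      have h1 : ‖w‖ ≤ ‖w - z‖ + ‖z‖ := norm_le_norm_sub_add w z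
      rw [mem_sphere_iff_norm.1 hw] at h1
      rw [mul_assoc, ← Real.exp_add]
      gcongr
      nlinarith)
  simpa using this

lemma ch_pow_deriv {g : ℂ → ℂ} (hg : Differentiable ℂ g) (n : ℕ) (z : ℂ) :
    HasDerivAt (fun z => g z ^ (n + 1) / (n + 1)) (g z ^ n * deriv g z) z := by
  have := (((hg z).hasDerivAt).pow (n + 1)).div_const ((n : ℂ) + 1)
  refine this.congr_deriv ?_
  have : (n : ℂ) + 1 ≠ 0 := by exact_mod_cast Nat.succ_ne_zero n
  push_cast
  field_simp

open Polynomial in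
/-- zeros of `g` are finite -/
lemma ch_zeros_finite {g : ℂ → ℂ} (hg : Differentiable ℂ g) {n : ℕ} (hn : 1 ≤ n) {c : ℂ}
    (hc : c ≠ 0) {P : Polynomial ℂ} (hP : P ≠ 0) {a : ℂ}
    (h : ∀ z, g z ^ n * deriv g z - c = P.eval z * Complex.exp (a * z)) :
    (∀ z, g z = 0) ∨ {z | g z = 0}.Finite := by
  have hn0 : n ≠ 0 := by omega
  have hz1 : ∀ z, g z = 0 → P.eval z * Complex.exp (a * z) = - c := by
    intro z hz
    rw [← h z, hz, zero_pow hn0]; ring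
  by_cases ha : a = 0
  · subst ha
    by_cases hW : C c + P = 0
    · have hd : ∀ z, HasDerivAt (fun z => g z ^ (n + 1) / (n + 1)) 0 z := by
        intro z
        refine (ch_pow_deriv hg n z).congr_deriv ?_
        have h1 := h z
        have h2 : (C c + P).eval z = 0 := by rw [hW, eval_zero]
        simp at h1 h2
        linear_combination h1 + h2
      have hconst : ∀ z w, g z ^ (n + 1) / (n + 1) = g w ^ (n + 1) / (n + 1) :=
        is_const_of_deriv_eq_zero (fun z => (hd z).differentiableAt) (fun z => (hd z).deriv)
      have hn1 : (n : ℂ) + 1 ≠ 0 := by exact_mod_cast Nat.succ_ne_zero n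
      by_cases h0 : ∃ w, g w = 0
      · left
        obtain ⟨w, hw⟩ := h0
        intro z
        have := hconst z w
        rw [hw, zero_pow (Nat.succ_ne_zero n), zero_div, div_eq_zero_iff] at this
        exact eq_zero_of_pow_eq_zero (this.resolve_right hn1)
      · right
        push Not at h0
        have : {z | g z = 0} = ∅ := by ext z; simp [h0 z]
        rw [this]; exact Set.finite_empty
    · right
      apply (Polynomial.finite_setOfPred_isRoot hW).subset
      intro z hz
      have := hz1 z hz
      simp at this
      show (C c + P).eval z = 0
      simp [this]
  · right
    obtain ⟨Q, hQ⟩ := ch_T_surj ha _ P (ch_deg_lt P)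
    have hd : ∀ z, HasDerivAt (fun z => g z ^ (n + 1) / (n + 1) - c * z
        - Q.eval z * Complex.exp (a * z)) 0 z := by
      intro z
      refine (((ch_pow_deriv hg n z).sub ((hasDerivAt_id z).const_mul c)).sub
        (ch_hasDeriv Q a z)).congr_deriv ?_
      rw [hQ, ← h z]; ring
    have hconst := is_const_of_deriv_eq_zero (fun z => (hd z).differentiableAt)
      (fun z => (hd z).deriv)
    obtain ⟨d, hd'⟩ : ∃ d, ∀ z, g z ^ (n + 1) / (n + 1) - c * z
        - Q.eval z * Complex.exp (a * z) = d := ⟨_, fun z => hconst z 0⟩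
    set W : Polynomial ℂ := P * (C c * X + C d) - C c * Q with hWdef
    have hQ0 : Q ≠ 0 := by rintro rfl; apply hP; rw [← hQ]; simp
    have hdeg : degree P = degree Q := by
      rw [← hQ, degree_add_eq_right_of_degree_lt, degree_C_mul ha]
      rw [degree_C_mul ha]; exact degree_derivative_lt hQ0
    have hW : W ≠ 0 := by
      intro hW0
      have h1 : P * (C c * X + C d) = C c * Q := sub_eq_zero.1 hW0
      have h2 := congrArg degree h1
      rw [degree_mul, degree_linear hc, degree_C_mul hc, hdeg, degree_eq_natDegree hQ0] at h2
      have h3 : natDegree Q + 1 = natDegree Q := by exact_mod_cast h2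
      omega
    apply (Polynomial.finite_setOfPred_isRoot hW).subset
    intro z hz
    have h1 := hz1 z hz
    have h2 := hd' z
    have hz' : g z = 0 := hz
    rw [hz', zero_pow (Nat.succ_ne_zero n), zero_div] at h2
    show W.eval z = 0
    rw [hWdef]
    simp
    linear_combination (-Q.eval z) * h1 - P.eval z * h2

open Polynomial in
lemma ch_X {g : ℂ → ℂ} (hg : Differentiable ℂ g) {A B : ℝ} (hA : 0 ≤ A)
    (hB : 0 ≤ B) (hb : ∀ z, ‖g z‖ ≤ A * Real.exp (B * ‖z‖)) {n : ℕ} (hn : 1 ≤ n) {c : ℂ}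
    (hc : c ≠ 0) (hfin : {z | g z ^ n * deriv g z = c}.Finite) :
    ∃ p : Polynomial ℂ, ∀ z, g z = p.eval z := by
  have hG : Differentiable ℂ (fun z => g z ^ n * deriv g z - c) :=
    ((hg.pow n).mul hg.deriv).sub_const c
  obtain ⟨P, a, hP, hPa⟩ := ch_factor hG (A := A ^ n * (A * Real.exp B) + ‖c‖)
    (B := n * B + B) (by positivity) (by positivity) (fun z => by
      have h1 : ‖g z ^ n‖ ≤ A ^ n * Real.exp (n * B * ‖z‖) := by
        rw [norm_pow]
        calc _ ≤ (A * Real.exp (B * ‖z‖)) ^ n := by gcongr; exact hb z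
          _ = _ := by rw [mul_pow, ← Real.exp_nat_mul, mul_assoc]
      have h2 := ch_deriv_growth hg hA hB hb z
      have h3 : ‖g z ^ n * deriv g z‖ ≤ A ^ n * (A * Real.exp B) * Real.exp ((n * B + B) * ‖z‖) := by
        rw [norm_mul]
        calc _ ≤ (A ^ n * Real.exp (n * B * ‖z‖)) * (A * Real.exp B * Real.exp (B * ‖z‖)) := by
              gcongr
          _ = _ := by rw [add_mul, Real.exp_add]; ring
      have h4 : 1 ≤ Real.exp ((n * B + B) * ‖z‖) := Real.one_le_exp (by positivity)
      have h5 : ‖c‖ ≤ ‖c‖ * Real.exp ((n * B + B) * ‖z‖) := by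
        nlinarith [norm_nonneg c]
      calc _ ≤ ‖g z ^ n * deriv g z‖ + ‖c‖ := norm_sub_le _ _
        _ ≤ _ := by rw [add_mul]; linarith)
      (by simpa [sub_eq_zero] using hfin)
  rcases ch_zeros_finite hg hn hc hP hPa with h0 | h0
  · exact ⟨0, fun z => by simp [h0 z]⟩
  obtain ⟨R, b, hR, hgR⟩ := ch_factor hg hA hB hb h0
  by_cases hb0 : b = 0
  · exact ⟨R, fun z => by rw [hgR z, hb0]; simp⟩
  exfalso
  set S : Polynomial ℂ := R ^ n * (derivative R + C b * R) with hS
  have hS0 : S ≠ 0 := mul_ne_zero (pow_ne_zero _ hR) (fun h => hR (ch_T_inj hb0 h))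
  set m : ℂ := (n + 1) * b with hm
  have hn1 : (n : ℂ) + 1 ≠ 0 := by exact_mod_cast Nat.succ_ne_zero n
  have hm0 : m ≠ 0 := mul_ne_zero hn1 hb0
  have key : ∀ z, S.eval z * Complex.exp (m * z) - c = P.eval z * Complex.exp (a * z) := by
    intro z
    rw [← hPa z]
    have hgf : g = fun z => R.eval z * Complex.exp (b * z) := _root_.funext hgR
    have hd : deriv g z = (derivative R + C b * R).eval z * Complex.exp (b * z) := by
      rw [hgf]; exact (ch_hasDeriv R b z).deriv
    rw [hd, hgR z, hS]
    have e : Complex.exp (m * z) = Complex.exp (b * z) ^ n * Complex.exp (b * z) := by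
      rw [← pow_succ, ← Complex.exp_nat_mul, hm]; push_cast; ring_nf
    rw [e, eval_mul, eval_pow, mul_pow]; ring
  by_cases ha : a = 0
  · subst ha
    apply hS0
    apply ch_indep1 hm0 _ (-C c - P) S (ch_deg_lt _)
    intro z
    have := key z
    simp at this ⊢
    linear_combination this
  by_cases ham : a = m
  · have : S - P = 0 := by
      apply ch_indep1 hm0 _ (-C c) (S - P) (ch_deg_lt _)
      intro z
      have := key z
      rw [ham] at this
      simp
      linear_combination this
    have h2 := key 0
    rw [sub_eq_zero.1 this, ham] at h2
    apply hc
    linear_combination -h2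
  · apply hS0
    apply ch_indep2 ha hm0 ham _ (-C c) (-P) S (ch_deg_lt _)
    intro z
    have := key z
    simp
    linear_combination this

open Polynomial in
lemma ch_poly {g : ℂ → ℂ} {p : Polynomial ℂ} (hp : ∀ z, g z = p.eval z) {n : ℕ} (hn : 1 ≤ n)
    {c : ℂ} (h : ∀ z, g z ^ n * deriv g z ≠ c) : ∀ z, deriv g z = 0 := by
  have hgf : g = fun z => p.eval z := _root_.funext hp
  have hd : ∀ z, deriv g z = (derivative p).eval z := by
    intro z; rw [hgf]; exact p.deriv
  by_cases hdp : derivative p = 0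
  · intro z; rw [hd, hdp, eval_zero]
  exfalso
  have hp0 : p ≠ 0 := by rintro rfl; simp at hdp
  have hdeg1 : natDegree p ≠ 0 := by
    intro h0
    exact hdp (derivative_of_natDegree_zero h0)
  set W : Polynomial ℂ := p ^ n * derivative p with hW
  have hWd : 0 < natDegree W := by
    rw [hW, natDegree_mul (pow_ne_zero _ hp0) hdp, natDegree_pow]
    have : 0 < n * natDegree p := Nat.mul_pos (by omega) (Nat.pos_of_ne_zero hdeg1)
    omega
  have hroot : ∃ z, (W - C c).eval z = 0 := by
    apply Complex.exists_root
    rw [degree_sub_C]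
    · exact natDegree_pos_iff_degree_pos.1 hWd
    · exact natDegree_pos_iff_degree_pos.1 hWd
  obtain ⟨z, hz⟩ := hroot
  apply h z
  rw [hd, hp]
  simp [hW] at hz
  exact sub_eq_zero.1 hz


lemma ch_montel {F : ℕ → ℂ → ℂ} (hF : ∀ k, Differentiable ℂ (F k)) (φ : Ultrafilter ℕ)
    {M : ℝ → ℝ} (hb : ∀ r, ∀ᶠ k in (φ : Filter ℕ), ∀ z, ‖z‖ ≤ r → ‖F k z‖ ≤ M r) :
    ∃ g : ℂ → ℂ, TendstoLocallyUniformlyOn F g φ univ := by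
  have hpt : ∀ z, ∃ y, Tendsto (fun k => F k z) φ (𝓝 y) := by
    intro z
    obtain ⟨y, -, hy⟩ := (isCompact_closedBall (0 : ℂ) (M ‖z‖)).ultrafilter_le_nhds
      (φ.map (fun k => F k z)) (by
        rw [le_principal_iff, Ultrafilter.coe_map, mem_map]
        filter_upwards [hb ‖z‖] with k hk
        simpa using hk z le_rfl)
    exact ⟨y, hy⟩
  choose g hg using hpt
  refine ⟨g, ?_⟩
  rw [tendstoLocallyUniformlyOn_univ, Metric.tendstoLocallyUniformly_iff]
  intro ε hε x
  set L : ℝ := max 1 (M (‖x‖ + 2)) with hL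
  have hL1 : 1 ≤ L := le_max_left _ _
  have hlip : ∀ᶠ k in (φ : Filter ℕ), ∀ y ∈ ball x 1, ‖F k y - F k x‖ ≤ L * ‖y - x‖ := by
    filter_upwards [hb (‖x‖ + 2)] with k hk y hy
    refine (convex_ball x 1).norm_image_sub_le_of_norm_deriv_le (f := F k) (C := L)
      (fun w _ => hF k w) ?_ (mem_ball_self one_pos) hy
    intro w hw
    have := Complex.norm_deriv_le_of_forall_mem_sphere_norm_le (c := w) (R := 1)
      (C := L) one_pos (hF k).diffContOnCl (fun v hv => by
        refine (hk v ?_).trans (le_max_right _ _)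
        have h1 : ‖v‖ ≤ ‖v - w‖ + ‖w‖ := norm_le_norm_sub_add v w
        have h2 : ‖w‖ ≤ ‖w - x‖ + ‖x‖ := norm_le_norm_sub_add w x
        rw [mem_sphere_iff_norm.1 hv] at h1
        have := mem_ball_iff_norm.1 hw
        linarith)
    simpa using this
  have hlipg : ∀ y ∈ ball x 1, ‖g y - g x‖ ≤ L * ‖y - x‖ := by
    intro y hy
    refine le_of_tendsto ((hg y).sub (hg x)).norm ?_
    filter_upwards [hlip] with k hk using hk y hy
  refine ⟨ball x (min 1 (ε / (3 * L))), ball_mem_nhds _ (by positivity), ?_⟩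
  filter_upwards [hlip, (Metric.tendsto_nhds.1 (hg x)) (ε / 3) (by positivity)] with k hk hkx y hy
  have hy1 : y ∈ ball x 1 := ball_subset_ball (min_le_left _ _) hy
  have hy2 : ‖y - x‖ < ε / (3 * L) := lt_of_lt_of_le (mem_ball_iff_norm.1 hy) (min_le_right _ _)
  have hy3 : L * ‖y - x‖ < ε / 3 := by
    rw [lt_div_iff₀ (by positivity)] at hy2
    linarith
  have a1 := hlipg y hy1
  have a2 := hk y hy1
  rw [dist_eq_norm] at hkx ⊢
  calc ‖g y - F k y‖ = ‖(g y - g x) - (F k x - g x) - (F k y - F k x)‖ := by congr 1; ring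
    _ ≤ ‖g y - g x‖ + ‖F k x - g x‖ + ‖F k y - F k x‖ :=
      (norm_sub_le _ _).trans (by gcongr; exact norm_sub_le _ _)
    _ < ε := by linarith

lemma ch_hurwitz {H : ℕ → ℂ → ℂ} {h : ℂ → ℂ} (hH : ∀ k, Differentiable ℂ (H k))
    {φ : Filter ℕ} [φ.NeBot] (hl : TendstoLocallyUniformlyOn H h φ univ)
    (hne : ∀ r : ℝ, ∀ᶠ k in φ, ∀ z, ‖z‖ ≤ r → H k z ≠ 0) :
    (∀ z, h z = 0) ∨ ∀ z, h z ≠ 0 := by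
  have hd : DifferentiableOn ℂ h univ :=
    hl.differentiableOn (Eventually.of_forall fun k => (hH k).differentiableOn) isOpen_univ
  have han : AnalyticOnNhd ℂ h univ := hd.analyticOnNhd isOpen_univ
  have hcont : Continuous h := (differentiableOn_univ.1 hd).continuous
  by_contra! hcon
  obtain ⟨⟨z1, hz1⟩, z0, hz0⟩ := hcon
  rcases (han z0 (mem_univ _)).eventually_eq_zero_or_eventually_ne_zero with h1 | h1
  · exact hz1 (han.eqOn_zero_of_preconnected_of_eventuallyEq_zero isPreconnected_univ
      (mem_univ z0) h1 (mem_univ z1))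
  rw [eventually_nhdsWithin_iff, Metric.eventually_nhds_iff_ball] at h1
  obtain ⟨r, hr, h1⟩ := h1
  have hsph : ∀ z ∈ sphere z0 (r / 2), h z ≠ 0 := by
    intro z hz
    apply h1 z
    · rw [mem_ball, mem_sphere.1 hz]; linarith
    · rintro rfl
      rw [mem_sphere, dist_self] at hz; linarith
  obtain ⟨w, hw, hmin⟩ := (isCompact_sphere z0 (r / 2)).exists_isMinOn
    (NormedSpace.sphere_nonempty.2 (by positivity)) hcont.norm.continuousOn
  set ε := ‖h w‖ with hε
  have hεpos : 0 < ε := norm_pos_iff.2 (hsph w hw)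
  have hu := (tendstoLocallyUniformlyOn_iff_forall_isCompact isOpen_univ).1 hl
    (sphere z0 (r / 2)) (subset_univ _) (isCompact_sphere _ _)
  rw [Metric.tendstoUniformlyOn_iff] at hu
  have key : ∀ᶠ k in φ, ε / 2 ≤ ‖H k z0‖ := by
    filter_upwards [hu (ε / 2) (by positivity), hne (‖z0‖ + r)] with k hk hk2
    have hnz : ∀ z ∈ closedBall z0 (r / 2), H k z ≠ 0 := by
      intro z hz
      apply hk2
      have h1 : ‖z‖ ≤ ‖z - z0‖ + ‖z0‖ := norm_le_norm_sub_add z z0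
      have := mem_closedBall_iff_norm.1 hz
      linarith
    have hmax := Complex.norm_le_of_forall_mem_frontier_norm_le (U := ball z0 (r / 2))
      (f := fun z => (H k z)⁻¹) (C := (ε / 2)⁻¹) isBounded_ball
      (by
        apply DifferentiableOn.diffContOnCl
        rw [closure_ball _ (by positivity)]
        exact fun z hz => ((hH k z).inv (hnz z hz)).differentiableWithinAt)
      (by
        intro z hz
        rw [frontier_ball _ (by positivity)] at hz
        rw [norm_inv]
        apply inv_anti₀ (by positivity)
        have a1 : ε ≤ ‖h z‖ := hmin hz
        have a2 := hk z hz
        rw [dist_eq_norm] at a2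
        have a3 := norm_le_norm_sub_add (h z) (H k z)
        linarith)
      (z := z0) (subset_closure (mem_ball_self (by positivity)))
    rw [norm_inv] at hmax
    exact (inv_le_inv₀ (norm_pos_iff.2 (hnz z0 (mem_closedBall_self (by positivity))))
      (by positivity)).1 hmax
  have := ge_of_tendsto (hl.tendsto_at (mem_univ z0)).norm key
  rw [hz0, norm_zero] at this
  linarith


lemma ch_not_const {g : ℂ → ℂ} (hg : Differentiable ℂ g) {n : ℕ} (hn : 1 ≤ n) {c : ℂ}
    (hc : c ≠ 0) (h : ∀ z, g z ^ n * deriv g z = c) : False := by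
  have hn0 : n ≠ 0 := by omega
  set u : ℂ → ℂ := fun z => g z ^ (n + 1) / (n + 1) - c * z with hu
  have hd : ∀ z, HasDerivAt u 0 z := by
    intro z
    have := (ch_pow_deriv hg n z).sub ((hasDerivAt_id z).const_mul c)
    refine this.congr_deriv ?_
    rw [h z]; simp
  have hconst : ∀ z, u z = u 0 := fun z =>
    is_const_of_deriv_eq_zero (fun w => (hd w).differentiableAt) (fun w => (hd w).deriv) z 0
  have h1 := hconst (-(u 0) / c)
  have h2 : g (-(u 0) / c) ^ (n + 1) / (n + 1) = 0 := by
    have h3 : u (-(u 0) / c) = g (-(u 0) / c) ^ (n + 1) / (n + 1) - c * (-(u 0) / c) := rfl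
    rw [h3, mul_div_cancel₀ _ hc] at h1
    linear_combination h1
  have hn1 : (n : ℂ) + 1 ≠ 0 := by exact_mod_cast Nat.succ_ne_zero n
  have h4 : g (-(u 0) / c) = 0 := by
    rw [div_eq_zero_iff] at h2
    exact pow_eq_zero_iff (Nat.succ_ne_zero n) |>.1 (h2.resolve_right hn1)
  have := h (-(u 0) / c)
  rw [h4, zero_pow hn0, zero_mul] at this
  exact hc this.symm

lemma ch_limit {F : ℕ → ℂ → ℂ} (hF : ∀ k, Differentiable ℂ (F k)) {A B : ℝ} (hA : 0 ≤ A)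
    (hB : 0 ≤ B) (hb : ∀ (k : ℕ) z, 2 * ‖z‖ ≤ k → ‖F k z‖ ≤ A * Real.exp (B * ‖z‖))
    (h0 : ∀ k, 1 ≤ ‖deriv (F k) 0‖) {n : ℕ} (hn : 1 ≤ n) {c : ℂ} (hc : c ≠ 0)
    (hne : ∀ (k : ℕ) z, ‖z‖ ≤ k → F k z ^ n * deriv (F k) z ≠ c) : False := by
  set φ : Ultrafilter ℕ := Ultrafilter.of atTop with hφ
  have hle : (φ : Filter ℕ) ≤ atTop := Ultrafilter.of_le _
  have hev : ∀ r : ℝ, ∀ᶠ k : ℕ in (φ : Filter ℕ), r ≤ k := fun r =>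
    hle (tendsto_natCast_atTop_atTop.eventually_ge_atTop r)
  have hbr : ∀ r : ℝ, ∀ᶠ k in (φ : Filter ℕ), ∀ z, ‖z‖ ≤ r → ‖F k z‖ ≤ A * Real.exp (B * r) := by
    intro r
    filter_upwards [hev (2 * r)] with k hk z hz
    refine (hb k z (by linarith)).trans ?_
    gcongr
  have hdr : ∀ r : ℝ, ∀ᶠ k in (φ : Filter ℕ), ∀ z, ‖z‖ ≤ r →
      ‖deriv (F k) z‖ ≤ A * Real.exp (B * (r + 1)) := by
    intro r
    filter_upwards [hbr (r + 1)] with k hk z hz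
    have := Complex.norm_deriv_le_of_forall_mem_sphere_norm_le (c := z) (R := 1)
      (C := A * Real.exp (B * (r + 1))) one_pos (hF k).diffContOnCl (fun v hv => by
        apply hk v
        have h1 : ‖v‖ ≤ ‖v - z‖ + ‖z‖ := norm_le_norm_sub_add v z
        rw [mem_sphere_iff_norm.1 hv] at h1
        linarith)
    simpa using this
  obtain ⟨g, hg⟩ := ch_montel hF φ hbr
  have hFd : ∀ᶠ k in (φ : Filter ℕ), DifferentiableOn ℂ (F k) univ :=
    Eventually.of_forall fun k => (hF k).differentiableOn
  have hgd : Differentiable ℂ g := differentiableOn_univ.1 (hg.differentiableOn hFd isOpen_univ)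
  have hgt : ∀ z, Tendsto (fun k => F k z) φ (𝓝 (g z)) := fun z => hg.tendsto_at (mem_univ z)
  have hgt' : ∀ z, Tendsto (fun k => deriv (F k) z) φ (𝓝 (deriv g z)) := fun z =>
    (hg.deriv hFd isOpen_univ).tendsto_at (mem_univ z)
  have hg0 : 1 ≤ ‖deriv g 0‖ := ge_of_tendsto (hgt' 0).norm (Eventually.of_forall h0)
  have hgb : ∀ z, ‖g z‖ ≤ A * Real.exp (B * ‖z‖) := by
    intro z
    refine le_of_tendsto (hgt z).norm ?_
    filter_upwards [hbr ‖z‖] with k hk using hk z le_rfl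
  set H : ℕ → ℂ → ℂ := fun k z => F k z ^ n * deriv (F k) z - c with hH
  have hHd : ∀ k, Differentiable ℂ (H k) := fun k =>
    (((hF k).pow n).mul ((hF k).deriv)).sub_const c
  obtain ⟨h, hh⟩ := ch_montel hHd φ
    (M := fun r => (A * Real.exp (B * r)) ^ n * (A * Real.exp (B * (r + 1))) + ‖c‖) (by
      intro r
      filter_upwards [hbr r, hdr r] with k h1 h2 z hz
      refine (norm_sub_le _ _).trans ?_
      rw [norm_mul, norm_pow]
      have := h1 z hz
      have := h2 z hz
      gcongr)
  have hheq : ∀ z, h z = g z ^ n * deriv g z - c := fun z =>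
    tendsto_nhds_unique (hh.tendsto_at (mem_univ z))
      ((((hgt z).pow n).mul (hgt' z)).sub_const c)
  rcases ch_hurwitz hHd hh (by
    intro r
    filter_upwards [hev r] with k hk z hz
    exact sub_ne_zero.2 (hne k z (hz.trans hk))) with h1 | h1
  · exact ch_not_const hgd hn hc (fun z => by
      have := h1 z
      rw [hheq, sub_eq_zero] at this
      exact this)
  · have h2 : ∀ z, g z ^ n * deriv g z ≠ c := fun z => by
      have := h1 z
      rw [hheq, sub_ne_zero] at this
      exact this
    obtain ⟨p, hp⟩ := ch_X hgd hA hB hgb hn hc (by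
      convert Set.finite_empty
      ext z
      simpa using h2 z)
    have := ch_poly hp hn h2 0
    rw [this, norm_zero] at hg0
    linarith

lemma ch_double {f : ℂ → ℂ} (hf : Differentiable ℂ f) {n : ℕ} (hn : 1 ≤ n) {k : ℝ} (hk : 0 ≤ k)
    {s : ℝ} (hs : 0 < s) {z₀ : ℂ} (hbad : s ^ 2 + ‖f z₀‖ ^ 2 < s ^ (n + 2) * ‖deriv f z₀‖) :
    ∃ (t : ℝ) (z : ℂ), 0 < t ∧ t ≤ s ∧ t ^ 2 + ‖f z‖ ^ 2 < t ^ (n + 2) * ‖deriv f z‖ ∧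
      ‖z - z₀‖ ≤ 2 * k * s ^ (n + 1) ∧ ∀ w, ‖w - z‖ ≤ k * t ^ (n + 1) →
        (t / 2) ^ (n + 2) * ‖deriv f w‖ ≤ (t / 2) ^ 2 + ‖f w‖ ^ 2 := by
  by_contra! hcon
  have hind : ∀ j : ℕ, ∃ z, (s / 2 ^ j) ^ 2 + ‖f z‖ ^ 2 < (s / 2 ^ j) ^ (n + 2) * ‖deriv f z‖ ∧
      ‖z - z₀‖ ≤ 2 * k * s ^ (n + 1) * (1 - 1 / 2 ^ j) := by
    intro j
    induction j with
    | zero => exact ⟨z₀, by simpa using hbad, by simp⟩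
    | succ j ih =>
      obtain ⟨z, h1, h2⟩ := ih
      have hP : 0 ≤ k * s ^ (n + 1) := by positivity
      have hj : (0 : ℝ) < 1 / 2 ^ j := by positivity
      have hj1 : (1 : ℝ) ≤ 2 ^ j := one_le_pow₀ (by norm_num)
      obtain ⟨w, h3, h4⟩ := hcon (s / 2 ^ j) z (by positivity) (div_le_self hs.le hj1) h1
        (h2.trans (by nlinarith))
      refine ⟨w, ?_, ?_⟩
      · rw [show s / 2 ^ (j + 1) = s / 2 ^ j / 2 by rw [pow_succ, div_div]]; exact h4
      · have h5 : (s / 2 ^ j) ^ (n + 1) ≤ s ^ (n + 1) * (1 / 2 ^ j) := by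
          rw [div_pow, mul_one_div]
          gcongr
          exact le_self_pow₀ hj1 (by omega)
        have h6 : ‖w - z₀‖ ≤ ‖w - z‖ + ‖z - z₀‖ := by
          have := norm_add_le (w - z) (z - z₀)
          simpa using this
        have h7 : k * (s / 2 ^ j) ^ (n + 1) ≤ k * (s ^ (n + 1) * (1 / 2 ^ j)) := by gcongr
        have h8 : (1 : ℝ) / 2 ^ (j + 1) = (1 / 2 ^ j) / 2 := by rw [pow_succ, div_div]
        rw [h8]
        linarith
  obtain ⟨C, hC⟩ := (isCompact_closedBall z₀ (2 * k * s ^ (n + 1))).exists_bound_of_continuousOn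
    (f := deriv f) hf.deriv.continuous.continuousOn
  have hC0 : 0 ≤ C := (norm_nonneg _).trans (hC z₀ (mem_closedBall_self (by positivity)))
  have hlim : Tendsto (fun j : ℕ => s / 2 ^ j) atTop (𝓝 0) :=
    tendsto_const_nhds.div_atTop (tendsto_pow_atTop_atTop_of_one_lt (by norm_num))
  obtain ⟨j, hj⟩ := (hlim.eventually (gt_mem_nhds (show (0 : ℝ) < 1 / (C + 1) by positivity))).exists
  obtain ⟨z, h1, h2⟩ := hind j
  have htpos : 0 < s / 2 ^ j := by positivity
  generalize s / 2 ^ j = t at hj h1 htpos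
  have hzC := hC z (by
    rw [mem_closedBall_iff_norm]
    refine h2.trans ?_
    have hP : 0 ≤ k * s ^ (n + 1) := by positivity
    have hj : (0 : ℝ) < 1 / 2 ^ j := by positivity
    nlinarith)
  rw [lt_div_iff₀ (by positivity)] at hj
  have ht1 : t ≤ 1 := by nlinarith
  have htn : t ^ n ≤ t := pow_le_of_le_one htpos.le ht1 (by omega)
  have h3 : t ^ (n + 2) * ‖deriv f z‖ ≤ t ^ 2 * (t * C) := by
    rw [pow_add, mul_comm (t ^ n), mul_assoc]
    gcongr
  have h4 : t * C < 1 := by nlinarith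
  have h5 : 0 < t ^ 2 := by positivity
  nlinarith [sq_nonneg ‖f z‖]

lemma ch_rescale {f : ℂ → ℂ} (hf : Differentiable ℂ f) {n : ℕ} {t : ℝ} (ht : 0 < t) (z : ℂ) :
    ∃ F : ℂ → ℂ, Differentiable ℂ F ∧ (∀ w, F w = f (z + t ^ (n + 1) * w) / t) ∧
      ∀ w, deriv F w = t ^ n * deriv f (z + t ^ (n + 1) * w) := by
  have ht0 : (t : ℂ) ≠ 0 := by exact_mod_cast ht.ne'
  have hd : ∀ w, HasDerivAt (fun w => f (z + t ^ (n + 1) * w) / t)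
      (t ^ n * deriv f (z + t ^ (n + 1) * w)) w := by
    intro w
    have h1 : HasDerivAt (fun w : ℂ => z + (t : ℂ) ^ (n + 1) * w) ((t : ℂ) ^ (n + 1)) w := by
      simpa using ((hasDerivAt_id w).const_mul ((t : ℂ) ^ (n + 1))).const_add z
    have := ((hf (z + t ^ (n + 1) * w)).hasDerivAt.comp w h1).div_const (t : ℂ)
    refine this.congr_deriv ?_
    field_simp
    ring
  exact ⟨_, fun w => (hd w).differentiableAt, fun w => rfl, fun w => (hd w).deriv⟩

lemma ch_seq {f : ℂ → ℂ} (hf : Differentiable ℂ f) {n : ℕ} (hn : 1 ≤ n) {c : ℂ} {R : ℝ}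
    (hR : ∀ z, R < ‖z‖ → f z ^ n * deriv f z ≠ c)
    (hbad : ∀ s : ℝ, 0 < s → ∃ z, R + 1 < ‖z‖ ∧ s ^ 2 + ‖f z‖ ^ 2 < s ^ (n + 2) * ‖deriv f z‖)
    {k : ℝ} (hk : 0 < k) :
    ∃ F : ℂ → ℂ, Differentiable ℂ F ∧
      (∀ w, ‖w‖ ≤ k → ‖deriv F w‖ ≤ 2 ^ (n + 2) * (1 + ‖F w‖ ^ 2)) ∧
      1 * (1 + ‖F 0‖ ^ 2) ≤ ‖deriv F 0‖ ∧ ∀ w, ‖w‖ ≤ k → F w ^ n * deriv F w ≠ c := by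
  set s : ℝ := min 1 (1 / (3 * k)) with hs
  have hs0 : 0 < s := by positivity
  have hs1 : s ≤ 1 := min_le_left _ _
  have hsk : 3 * k * s ≤ 1 := by
    have : s ≤ 1 / (3 * k) := min_le_right _ _
    rw [le_div_iff₀ (by positivity)] at this
    linarith
  obtain ⟨z₀, hz₀, hb₀⟩ := hbad s hs0
  obtain ⟨t, z, ht, hts, hb, hz, hgood⟩ := ch_double hf hn hk.le hs0 hb₀
  obtain ⟨F, hF, hFv, hFd⟩ := ch_rescale hf (n := n) ht z
  have hsn : s ^ (n + 1) ≤ s := pow_le_of_le_one hs0.le hs1 (by omega)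
  have htn : t ^ (n + 1) ≤ s := (pow_le_pow_left₀ ht.le hts _).trans hsn
  have ht0 : (t : ℂ) ≠ 0 := by exact_mod_cast ht.ne'
  have hnF : ∀ w, ‖f (z + t ^ (n + 1) * w)‖ = t * ‖F w‖ := by
    intro w
    rw [hFv, norm_div, Complex.norm_real, Real.norm_of_nonneg ht.le]
    field_simp
  have hnd : ∀ w, ‖deriv F w‖ = t ^ n * ‖deriv f (z + t ^ (n + 1) * w)‖ := by
    intro w
    rw [hFd, norm_mul, norm_pow, Complex.norm_real, Real.norm_of_nonneg ht.le]
  have hnw : ∀ w : ℂ, ‖(t : ℂ) ^ (n + 1) * w‖ = t ^ (n + 1) * ‖w‖ := by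
    intro w
    rw [norm_mul, norm_pow, Complex.norm_real, Real.norm_of_nonneg ht.le]
  have ht2 : 0 < t ^ 2 := by positivity
  refine ⟨F, hF, ?_, ?_, ?_⟩
  · intro w hw
    have h1 := hgood (z + t ^ (n + 1) * w) (by
      rw [add_sub_cancel_left, hnw, mul_comm k]
      gcongr)
    rw [hnF] at h1
    have h2 : (t / 2) ^ (n + 2) * ‖deriv f (z + t ^ (n + 1) * w)‖
        = t ^ 2 * (‖deriv F w‖ / 2 ^ (n + 2)) := by
      rw [hnd, div_pow, pow_add t]; ring
    rw [h2] at h1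
    have h3 : ‖deriv F w‖ / 2 ^ (n + 2) ≤ 1 + ‖F w‖ ^ 2 := by
      by_contra! h4
      nlinarith
    rw [div_le_iff₀ (by positivity)] at h3
    linarith
  · have h1 := hnF 0
    have h2 := hnd 0
    rw [mul_zero, add_zero] at h1 h2
    rw [h1] at hb
    have h3 : t ^ (n + 2) * ‖deriv f z‖ = t ^ 2 * ‖deriv F 0‖ := by rw [h2, pow_add]; ring
    rw [h3] at hb
    by_contra! h4
    nlinarith
  · intro w hw
    have h1 : F w ^ n * deriv F w
        = f (z + t ^ (n + 1) * w) ^ n * deriv f (z + t ^ (n + 1) * w) := by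
      rw [hFv, hFd, div_pow]; field_simp
    rw [h1]
    apply hR
    have a1 : ‖z₀‖ ≤ ‖z₀ - (z + t ^ (n + 1) * w)‖ + ‖z + t ^ (n + 1) * w‖ :=
      norm_le_norm_sub_add _ _
    have a2 : ‖z₀ - (z + t ^ (n + 1) * w)‖ ≤ ‖z - z₀‖ + ‖(t : ℂ) ^ (n + 1) * w‖ := by
      rw [← norm_neg (z₀ - (z + t ^ (n + 1) * w))]
      refine le_trans (le_of_eq ?_) (norm_add_le _ _)
      congr 1; ring
    rw [hnw] at a2
    have a3 : t ^ (n + 1) * ‖w‖ ≤ s * k := by gcongr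
    have a4 : 2 * k * s ^ (n + 1) ≤ 2 * k * s := by gcongr
    linarith

theorem clunie_hayman_entire (f : ℂ → ℂ) (hf : Differentiable ℂ f)
    (htrans : ¬ ∃ p : Polynomial ℂ, ∀ z : ℂ, f z = p.eval z)
    (n : ℕ) (hn : 1 ≤ n) (c : ℂ) (hc : c ≠ 0) :
    {z : ℂ | f z ^ n * deriv f z = c}.Infinite := by
  by_contra hcon
  have hfin : {z : ℂ | f z ^ n * deriv f z = c}.Finite := Set.not_infinite.1 hcon
  obtain ⟨R, hR⟩ := hfin.isBounded.exists_norm_le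
  have hR' : ∀ z, R < ‖z‖ → f z ^ n * deriv f z ≠ c := fun z hz h =>
    absurd (hR z h) (not_le.2 hz)
  by_cases hcase : ∀ s : ℝ, 0 < s →
      ∃ z, R + 1 < ‖z‖ ∧ s ^ 2 + ‖f z‖ ^ 2 < s ^ (n + 2) * ‖deriv f z‖
  · have hex : ∀ k : ℕ, _ := fun k : ℕ =>
      ch_seq hf hn hR' hcase (k := (k : ℝ) + 1) (by positivity)
    choose F hF hFb hF0 hFne using hex
    set K : ℝ := 2 ^ (n + 2) with hK
    have hK0 : 0 ≤ K := by positivity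
    set A : ℝ := 1 + 8 * K / 1 + 16 / 1 ^ 2 with hA
    have hA1 : 1 ≤ A := by rw [hA]; norm_num; linarith
    have hA0 : ∀ k, ‖F k 0‖ ≤ A := fun k =>
      ch_bound_zero (hF k) one_pos hK0 (R := (k : ℝ) + 1) (by simp) (hFb k) (hF0 k)
    refine ch_limit hF (A := A) (B := 4 * K * A) (by linarith) (by positivity) ?_ ?_ hn hc ?_
    · intro k z hz
      exact ch_growth (hF k) hA1 hK0 (hA0 k) (hFb k) (by linarith)
    · intro k
      have := hF0 k
      nlinarith [sq_nonneg ‖F k 0‖]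
    · intro k z hz
      exact hFne k z (by linarith)
  · push Not at hcase
    obtain ⟨s, hs, hgood⟩ := hcase
    obtain ⟨C, hC⟩ := (isCompact_closedBall (0 : ℂ) (R + 1)).exists_bound_of_continuousOn
      (f := deriv f) hf.deriv.continuous.continuousOn
    set K : ℝ := max (max C 0) (max (s ^ 2) 1 / s ^ (n + 2)) with hK
    have hKC : C ≤ K := (le_max_left _ _).trans (le_max_left _ _)
    have hK0 : 0 ≤ K := (le_max_right _ _).trans (le_max_left _ _)
    have hb : ∀ w, ‖deriv f w‖ ≤ K * (1 + ‖f w‖ ^ 2) := by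
      intro w
      by_cases hw : R + 1 < ‖w‖
      · have h1 := hgood w hw
        have h2 : s ^ (n + 2) * ‖deriv f w‖ ≤ max (s ^ 2) 1 * (1 + ‖f w‖ ^ 2) := by
          have := le_max_left (s ^ 2) 1
          have := le_max_right (s ^ 2) 1
          nlinarith [sq_nonneg ‖f w‖]
        have h3 : ‖deriv f w‖ ≤ max (s ^ 2) 1 / s ^ (n + 2) * (1 + ‖f w‖ ^ 2) := by
          rw [div_mul_eq_mul_div, le_div_iff₀ (by positivity)]
          linarith
        refine h3.trans ?_
        gcongr
        exact le_max_right _ _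
      · have := hC w (by simpa using hw)
        nlinarith [sq_nonneg ‖f w‖, mul_nonneg hK0 (sq_nonneg ‖f w‖)]
    have hA1 : 1 ≤ max 1 ‖f 0‖ := le_max_left _ _
    exact htrans (ch_X hf (A := max 1 ‖f 0‖) (B := 4 * K * max 1 ‖f 0‖) (by linarith)
      (by positivity) (fun z => ch_growth hf hA1 hK0 (le_max_right _ _)
        (R := 2 * ‖z‖) (fun w _ => hb w) le_rfl) hn hc hfin)
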